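/- Under Assumption 1, if q ∈ ℝ^n with q ≥ 0 satisfies the Bellman inequality q ≤ T(q) (equivalently, q ≤ s + A^T q + Σ_{i=1}^n min{r_i + B_i^T q, 0} E_i), then for every x_0 ≥ 0 and every admissible trajectory (x(t), u(t)) from x_0, the cost satisfies Σ_{t=0}^∞ [s^T x(t) + r^T u(t)] ≥ q^T x_0; consequently q^T x_0 ≤ V(x_0). -/

import Mathlib

open Matrix Finset

/-- `minZero v` is the minimum of the entries of `v` and of the scalar `0`. -/
noncomputable def minZero {k : ℕ} (v : Fin k → ℝ) : ℝ :=
  (insert (0 : ℝ) (Finset.image v Finset.univ)).min' (Finset.insert_nonempty _ _)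

/-- The Bellman operator `T(p) = s + Aᵀ p + Σ_i min{r_i + B_iᵀ p, 0} E_i`. -/
noncomputable def bellman {n : ℕ} {m : Fin n → ℕ}
    (A : Matrix (Fin n) (Fin n) ℝ) (B : ∀ i, Matrix (Fin n) (Fin (m i)) ℝ)
    (s : Fin n → ℝ) (r : ∀ i, Fin (m i) → ℝ) (E : Matrix (Fin n) (Fin n) ℝ)
    (p : Fin n → ℝ) : Fin n → ℝ :=
  fun j => s j + (Aᵀ *ᵥ p) j +
    ∑ i, minZero (fun l => r i l + ((B i)ᵀ *ᵥ p) l) * E i j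

/-- Membership in the set 𝒦 of blockwise nonnegative feedback matrices with
full (`1ᵀ K_i = E_iᵀ`) or zero (`1ᵀ K_i = 0`) actuation in each block. -/
def memK {n : ℕ} {m : Fin n → ℕ} (E : Matrix (Fin n) (Fin n) ℝ)
    (K : ∀ i, Matrix (Fin (m i)) (Fin n) ℝ) : Prop :=
  ∀ i, (∀ l j, 0 ≤ K i l j) ∧
    ((∀ j, ∑ l, K i l j = E i j) ∨ (∀ j, ∑ l, K i l j = 0))

/-- Assumption 1: `(A + BK) x ≥ 0` for every `K ∈ 𝒦` and every `x ≥ 0`. -/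
def assumption1 {n : ℕ} {m : Fin n → ℕ}
    (A : Matrix (Fin n) (Fin n) ℝ) (B : ∀ i, Matrix (Fin n) (Fin (m i)) ℝ)
    (E : Matrix (Fin n) (Fin n) ℝ) : Prop :=
  ∀ K : ∀ i, Matrix (Fin (m i)) (Fin n) ℝ, memK E K →
    ∀ x : Fin n → ℝ, 0 ≤ x → 0 ≤ (A + ∑ i, B i * K i) *ᵥ x

/-- The constraint set `U(x) = {u : u ≥ 0, 1ᵀ u_i ≤ E_iᵀ x for all i}`. -/
def inputSet {n : ℕ} {m : Fin n → ℕ} (E : Matrix (Fin n) (Fin n) ℝ)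
    (x : Fin n → ℝ) : Set (∀ i, Fin (m i) → ℝ) :=
  {u | ∀ i, (∀ l, 0 ≤ u i l) ∧ (∑ l, u i l) ≤ ∑ j, E i j * x j}

/-- An admissible trajectory from `x0`: `x(0) = x0`, `u(t) ∈ U(x(t))` and
`x(t+1) = A x(t) + B u(t)`. -/
def admissible {n : ℕ} {m : Fin n → ℕ}
    (A : Matrix (Fin n) (Fin n) ℝ) (B : ∀ i, Matrix (Fin n) (Fin (m i)) ℝ)
    (E : Matrix (Fin n) (Fin n) ℝ) (x0 : Fin n → ℝ)
    (x : ℕ → Fin n → ℝ) (u : ℕ → ∀ i, Fin (m i) → ℝ) : Prop :=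
  x 0 = x0 ∧ ∀ t, u t ∈ inputSet E (x t) ∧
    x (t + 1) = A *ᵥ x t + ∑ i, (B i) *ᵥ (u t i)

/-- The state trajectory generated by a control sequence `u` from `x0`. -/
noncomputable def traj {n : ℕ} {m : Fin n → ℕ}
    (A : Matrix (Fin n) (Fin n) ℝ) (B : ∀ i, Matrix (Fin n) (Fin (m i)) ℝ)
    (x0 : Fin n → ℝ) (u : ℕ → ∀ i, Fin (m i) → ℝ) : ℕ → Fin n → ℝ
  | 0 => x0
  | t + 1 => A *ᵥ traj A B x0 u t + ∑ i, (B i) *ᵥ (u t i)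

/-- Total cost `Σ_{t=0}^∞ [sᵀ x(t) + rᵀ u(t)] ∈ [0,∞]` of a trajectory. -/
noncomputable def trajCost {n : ℕ} {m : Fin n → ℕ}
    (s : Fin n → ℝ) (r : ∀ i, Fin (m i) → ℝ)
    (x : ℕ → Fin n → ℝ) (u : ℕ → ∀ i, Fin (m i) → ℝ) : ENNReal :=
  ∑' t, ENNReal.ofReal ((∑ j, s j * x t j) + ∑ i, ∑ l, r i l * u t i l)

/-- Optimal value `V(x0)`: infimum of the total cost over admissible trajectories. -/
noncomputable def optValue {n : ℕ} {m : Fin n → ℕ}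
    (A : Matrix (Fin n) (Fin n) ℝ) (B : ∀ i, Matrix (Fin n) (Fin (m i)) ℝ)
    (E : Matrix (Fin n) (Fin n) ℝ) (s : Fin n → ℝ) (r : ∀ i, Fin (m i) → ℝ)
    (x0 : Fin n → ℝ) : ENNReal :=
  ⨅ (x : ℕ → Fin n → ℝ) (u : ℕ → ∀ i, Fin (m i) → ℝ)
    (_ : admissible A B E x0 x u), trajCost s r x u

/-- The spectral radius of `M` is strictly less than `1`. -/
def schurStable {n : ℕ} (M : Matrix (Fin n) (Fin n) ℝ) : Prop :=
  ∀ μ ∈ spectrum ℂ (M.map Complex.ofReal), ‖μ‖ < 1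

theorem minZero_nonpos {k : ℕ} (v : Fin k → ℝ) : minZero v ≤ 0 :=
  Finset.min'_le _ _ (Finset.mem_insert_self _ _)

theorem minZero_le {k : ℕ} (v : Fin k → ℝ) (l : Fin k) : minZero v ≤ v l :=
  Finset.min'_le _ _
    (Finset.mem_insert_of_mem (Finset.mem_image_of_mem v (Finset.mem_univ l)))

theorem minZero_eq_zero_or_exists {k : ℕ} (v : Fin k → ℝ) :
    minZero v = 0 ∨ ∃ l, v l = minZero v := by
  have h : minZero v ∈ insert (0 : ℝ) (Finset.image v Finset.univ) := Finset.min'_mem _ _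
  simpa using h

/-- A linear form on `{w ≥ 0 : 1ᵀ w ≤ c}` is at least `c` times its minimal coefficient
truncated at `0`. -/
theorem minZero_mul_le_dotProduct {k : ℕ} (v w : Fin k → ℝ) {c : ℝ}
    (hw : ∀ l, 0 ≤ w l) (hc : ∑ l, w l ≤ c) : minZero v * c ≤ v ⬝ᵥ w :=
  calc minZero v * c ≤ minZero v * ∑ l, w l :=
        mul_le_mul_of_nonpos_left hc (minZero_nonpos v)
    _ = ∑ l, minZero v * w l := Finset.mul_sum _ _ _
    _ ≤ v ⬝ᵥ w := Finset.sum_le_sum fun l _ =>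
        mul_le_mul_of_nonneg_right (minZero_le v l) (hw l)

/-- For a fixed row of `B`, some feedback in `𝒦` attains the worst case over the inputs. -/
theorem exists_memK_worst_row {n : ℕ} {m : Fin n → ℕ}
    (B : ∀ i, Matrix (Fin n) (Fin (m i)) ℝ) {E : Matrix (Fin n) (Fin n) ℝ}
    (hE : ∀ i j, 0 ≤ E i j) (k : Fin n) :
    ∃ K : ∀ i, Matrix (Fin (m i)) (Fin n) ℝ, memK E K ∧
      ∀ i j, (B i * K i) k j = minZero (B i k) * E i j := by
  have h : ∀ i, ∃ K : Matrix (Fin (m i)) (Fin n) ℝ, ((∀ l j, 0 ≤ K l j) ∧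
      ((∀ j, ∑ l, K l j = E i j) ∨ (∀ j, ∑ l, K l j = 0))) ∧
      ∀ j, (B i * K) k j = minZero (B i k) * E i j := by
    intro i
    rcases minZero_eq_zero_or_exists (B i k) with h0 | ⟨l, hl⟩
    · exact ⟨0, by simp, by simp [h0]⟩
    · refine ⟨Matrix.of fun l' j => if l' = l then E i j else 0, ⟨fun l' j => ?_, ?_⟩, fun j => ?_⟩
      · rw [Matrix.of_apply]
        split_ifs
        exacts [hE i j, le_rfl]
      · left
        simp
      · simp [Matrix.mul_apply, ← hl]
  choose K hK hBK using h
  exact ⟨K, hK, hBK⟩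

theorem nonneg_step_of_assumption1 {n : ℕ} {m : Fin n → ℕ}
    {A : Matrix (Fin n) (Fin n) ℝ} {B : ∀ i, Matrix (Fin n) (Fin (m i)) ℝ}
    {E : Matrix (Fin n) (Fin n) ℝ} (hE : ∀ i j, 0 ≤ E i j) (hA1 : assumption1 A B E)
    {x : Fin n → ℝ} (hx : 0 ≤ x) {u : ∀ i, Fin (m i) → ℝ} (hu : u ∈ inputSet E x) :
    0 ≤ A *ᵥ x + ∑ i, B i *ᵥ u i := by
  intro k
  obtain ⟨K, hK, hBK⟩ := exists_memK_worst_row B hE k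
  have hrow : ∀ i, ((B i * K i) *ᵥ x) k = minZero (B i k) * ∑ j, E i j * x j := by
    intro i
    simp only [Matrix.mulVec, dotProduct, hBK, Finset.mul_sum, mul_assoc]
  calc (0 : ℝ) ≤ ((A + ∑ i, B i * K i) *ᵥ x) k := hA1 K hK x hx k
    _ = (A *ᵥ x) k + ∑ i, minZero (B i k) * ∑ j, E i j * x j := by
        simp only [Matrix.add_mulVec, Matrix.sum_mulVec, Pi.add_apply, Finset.sum_apply, hrow]
    _ ≤ (A *ᵥ x) k + ∑ i, (B i *ᵥ u i) k := by
        gcongr with i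
        exact minZero_mul_le_dotProduct _ _ (hu i).1 (hu i).2
    _ = (A *ᵥ x + ∑ i, B i *ᵥ u i) k := by
        simp only [Pi.add_apply, Finset.sum_apply]

theorem dotProduct_le_stage_add_of_le_bellman {n : ℕ} {m : Fin n → ℕ}
    {A : Matrix (Fin n) (Fin n) ℝ} {B : ∀ i, Matrix (Fin n) (Fin (m i)) ℝ}
    {s : Fin n → ℝ} {r : ∀ i, Fin (m i) → ℝ} {E : Matrix (Fin n) (Fin n) ℝ}
    {q : Fin n → ℝ} (hBell : q ≤ bellman A B s r E q)
    {x : Fin n → ℝ} (hx : 0 ≤ x) {u : ∀ i, Fin (m i) → ℝ} (hu : u ∈ inputSet E x) :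
    q ⬝ᵥ x ≤ (s ⬝ᵥ x + ∑ i, r i ⬝ᵥ u i) + q ⬝ᵥ (A *ᵥ x + ∑ i, B i *ᵥ u i) := by
  calc q ⬝ᵥ x ≤ bellman A B s r E q ⬝ᵥ x := dotProduct_le_dotProduct_of_nonneg_right hBell hx
    _ = s ⬝ᵥ x + (Aᵀ *ᵥ q) ⬝ᵥ x +
          ∑ i, minZero (r i + (B i)ᵀ *ᵥ q) * ∑ j, E i j * x j := by
        simp only [bellman, dotProduct, add_mul, Finset.sum_add_distrib, Finset.sum_mul,
          Finset.mul_sum, mul_assoc]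
        rw [Finset.sum_comm (s := Finset.univ) (t := Finset.univ)
          (f := fun j i => minZero (fun l => r i l + ((B i)ᵀ *ᵥ q) l) * (E i j * x j))]
        rfl
    _ ≤ s ⬝ᵥ x + (Aᵀ *ᵥ q) ⬝ᵥ x + ∑ i, (r i + (B i)ᵀ *ᵥ q) ⬝ᵥ u i := by
        gcongr with i
        exact minZero_mul_le_dotProduct _ _ (hu i).1 (hu i).2
    _ = (s ⬝ᵥ x + ∑ i, r i ⬝ᵥ u i) + q ⬝ᵥ (A *ᵥ x + ∑ i, B i *ᵥ u i) := by
        simp only [add_dotProduct, dotProduct_add, dotProduct_sum, Finset.sum_add_distrib,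
          Matrix.mulVec_transpose, Matrix.dotProduct_mulVec]
        ring

/-- If `a` decreases by at most `c t` at step `t` and is dominated by a multiple of the summable
sequence `c`, then `a 0` is at most the sum of `c`. -/
theorem ofReal_le_tsum_of_le_add_succ {a c : ℕ → ℝ} {C : ℝ} (hc : ∀ t, 0 ≤ c t)
    (hstep : ∀ t, a t ≤ c t + a (t + 1)) (hdom : ∀ t, a t ≤ C * c t) :
    ENNReal.ofReal (a 0) ≤ ∑' t, ENNReal.ofReal (c t) := by
  by_cases htop : ∑' t, ENNReal.ofReal (c t) = ⊤
  · simp [htop]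
  have hsum : Summable c := by
    simpa only [ENNReal.toReal_ofReal (hc _)] using ENNReal.summable_toReal htop
  rw [← ENNReal.ofReal_tsum_of_nonneg hc hsum]
  refine ENNReal.ofReal_le_ofReal ?_
  have htel : ∀ N, a 0 ≤ ∑ t ∈ Finset.range N, c t + a N := by
    intro N
    induction N with
    | zero => simp
    | succ N ih =>
      rw [Finset.sum_range_succ]
      linarith [hstep N]
  have hlim : Filter.Tendsto (fun N => ∑ t ∈ Finset.range N, c t + C * c N) Filter.atTop
      (nhds (∑' t, c t + C * 0)) :=
    hsum.hasSum.tendsto_sum_nat.add (hsum.tendsto_atTop_zero.const_mul C)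
  rw [mul_zero, add_zero] at hlim
  exact ge_of_tendsto' hlim fun N => (htel N).trans (by gcongr; exact hdom N)

theorem dotProduct_le_sum_div_mul_dotProduct {n : ℕ} {q s x : Fin n → ℝ}
    (hq : 0 ≤ q) (hs : ∀ j, 0 < s j) (hx : 0 ≤ x) :
    q ⬝ᵥ x ≤ (∑ j, q j / s j) * (s ⬝ᵥ x) := by
  rw [← smul_eq_mul, ← smul_dotProduct]
  refine dotProduct_le_dotProduct_of_nonneg_right (fun j => ?_) hx
  calc q j = q j / s j * s j := (div_mul_cancel₀ _ (hs j).ne').symm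
    _ ≤ (∑ j, q j / s j) * s j := mul_le_mul_of_nonneg_right
        (Finset.single_le_sum (f := fun j => q j / s j)
          (fun i _ => div_nonneg (hq i) (hs i).le) (Finset.mem_univ j)) (hs j).le

/-- under Assumption 1, if `q ≥ 0` satisfies the Bellman inequality
`q ≤ T(q)`, then every admissible trajectory from `x0 ≥ 0` has cost at least
`qᵀ x0`; consequently `qᵀ x0 ≤ V(x0)`. -/
theorem stmt_6 {n : ℕ} {m : Fin n → ℕ}
    (A : Matrix (Fin n) (Fin n) ℝ) (B : ∀ i, Matrix (Fin n) (Fin (m i)) ℝ)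
    (s : Fin n → ℝ) (r : ∀ i, Fin (m i) → ℝ) (E : Matrix (Fin n) (Fin n) ℝ)
    (hs : ∀ j, 0 < s j) (hr : ∀ i l, 0 ≤ r i l)
    (hE : ∀ i j, 0 ≤ E i j) (hEinv : IsUnit E.det)
    (hA1 : assumption1 A B E)
    (q : Fin n → ℝ) (hq : 0 ≤ q) (hBell : q ≤ bellman A B s r E q)
    (x0 : Fin n → ℝ) (hx0 : 0 ≤ x0) :
    (∀ x u, admissible A B E x0 x u →
      ENNReal.ofReal (∑ j, q j * x0 j) ≤ trajCost s r x u) ∧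
    ENNReal.ofReal (∑ j, q j * x0 j) ≤ optValue A B E s r x0 := by
  have hcost : ∀ x u, admissible A B E x0 x u →
      ENNReal.ofReal (∑ j, q j * x0 j) ≤ trajCost s r x u := by
    rintro x u ⟨rfl, hxu⟩
    have hx : ∀ t, 0 ≤ x t := by
      intro t
      induction t with
      | zero => exact hx0
      | succ t ih =>
        rw [(hxu t).2]
        exact nonneg_step_of_assumption1 hE hA1 ih (hxu t).1
    have hru : ∀ t, 0 ≤ ∑ i, r i ⬝ᵥ u t i := fun t =>
      Finset.sum_nonneg fun i _ => dotProduct_nonneg_of_nonneg (hr i) ((hxu t).1 i).1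
    have hsx : ∀ t, 0 ≤ s ⬝ᵥ x t := fun t =>
      dotProduct_nonneg_of_nonneg (fun j => (hs j).le) (hx t)
    refine ofReal_le_tsum_of_le_add_succ (a := fun t => q ⬝ᵥ x t)
      (c := fun t => s ⬝ᵥ x t + ∑ i, r i ⬝ᵥ u t i) (C := ∑ j, q j / s j)
      (fun t => add_nonneg (hsx t) (hru t)) (fun t => ?_) (fun t => ?_)
    · rw [(hxu t).2]
      exact dotProduct_le_stage_add_of_le_bellman hBell (hx t) (hxu t).1
    · exact (dotProduct_le_sum_div_mul_dotProduct hq hs (hx t)).trans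
        (mul_le_mul_of_nonneg_left (le_add_of_nonneg_right (hru t))
          (Finset.sum_nonneg fun j _ => div_nonneg (hq j) (hs j).le))
  exact ⟨hcost, le_iInf fun x => le_iInf fun u => le_iInf fun h => hcost x u h⟩
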